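/- arXiv:1911.01836 — 2 statements merged into one kernel-verified Lean document; each statement's English description precedes it below -/
import Mathlib

section
/- Proposition 1 (Symmetry of the PSA Liouvillian). Let N be a Hermitian n×n complex matrix and let L be a PSA Liouvillian associated with N. Then L commutes with the number superoperator 𝒩 : X ↦ NX − XN; that is, L(NX − XN) = N·L(X) − L(X)·N for every n×n complex matrix X. -/
open Matrix Finset

/-- A sandwich `X ↦ b * X * c` commutes with the commutator superoperator of `x` when `b` and `c`
carry opposite weights. -/
lemma sandwich_commutator {R : Type*} [Ring R] [Algebra ℂ R] {x b c : R} {r : ℂ} (hb : x * b - b * x = r • b)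
    (hc : c * x - x * c = r • c) (y : R) :
    b * (x * y - y * x) * c = x * (b * y * c) - b * y * c * x := by
  have hxb : x * b = b * x + r • b := by rw [← hb]; abel
  have hcx : c * x = x * c + r • c := by rw [← hc]; abel
  have h1 : x * (b * y * c) = b * x * y * c + r • (b * y * c) := by
    simp only [← mul_assoc, hxb, add_mul, smul_mul_assoc]
  have h2 : b * y * c * x = b * y * x * c + r • (b * y * c) := by
    simp only [mul_assoc, hcx, mul_add, mul_smul_comm]
  rw [h1, h2]
  simp only [mul_sub, sub_mul, mul_assoc]
  abel

/-- A product of elements of opposite weights has weight zero. -/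
lemma commute_mul_of_opposite_weights {R : Type*} [Ring R] [Algebra ℂ R] {x b c : R} {r : ℂ} (hb : x * b - b * x = r • b)
    (hc : c * x - x * c = r • c) : Commute x (c * b) := by
  have hxb : x * b = b * x + r • b := by rw [← hb]; abel
  have hxc : x * c = c * x - r • c := by rw [← hc]; abel
  change x * (c * b) = c * b * x
  rw [← mul_assoc, hxc, sub_mul, mul_assoc, hxb, mul_add, smul_mul_assoc, mul_smul_comm,
    mul_assoc]
  abel

lemma Commute.mul_commutator {R : Type*} [Ring R] {x m : R} (h : Commute x m) (y : R) :
    m * (x * y - y * x) = x * (m * y) - m * y * x := by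
  rw [← mul_assoc, h.eq]
  simp only [mul_sub, mul_assoc]

lemma Commute.commutator_mul {R : Type*} [Ring R] {x m : R} (h : Commute x m) (y : R) :
    (x * y - y * x) * m = x * (y * m) - y * m * x := by
  rw [mul_assoc y m, ← h.eq]
  simp only [sub_mul, mul_assoc]

/-- **Proposition 1 (Symmetry of the PSA Liouvillian).**
If `L` is a PSA Liouvillian associated with a Hermitian matrix `N`, then `L`
commutes with the number superoperator `𝒩 : X ↦ N*X - X*N`. -/
theorem psa_liouvillian_commutes_with_number_superoperator
    {n : ℕ} (N : Matrix (Fin n) (Fin n) ℂ) (hN : N.IsHermitian)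
    {ι : Type*} [Fintype ι]
    (γ s : ι → ℂ) (A B : ι → Matrix (Fin n) (Fin n) ℂ) (a : ι → ℝ)
    (H : Matrix (Fin n) (Fin n) ℂ) (hH : H.IsHermitian) (hNH : N * H = H * N)
    (hA : ∀ j, N * A j - A j * N = (a j : ℂ) • A j)
    (hB : ∀ j, N * B j - B j * N = (a j : ℂ) • B j)
    (H' : Matrix (Fin n) (Fin n) ℂ)
    (hH' : H' = H + ∑ j, s j • ((A j)ᴴ * B j))
    (L : Matrix (Fin n) (Fin n) ℂ →ₗ[ℂ] Matrix (Fin n) (Fin n) ℂ)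
    (hL : ∀ ρ, L ρ = -Complex.I • (H' * ρ - ρ * H') +
      ∑ j, γ j • (B j * ρ * (A j)ᴴ -
        (1 / 2 : ℂ) • ((A j)ᴴ * B j * ρ + ρ * ((A j)ᴴ * B j)))) :
    ∀ X : Matrix (Fin n) (Fin n) ℂ,
      L (N * X - X * N) = N * L X - L X * N := by
  intro X
  have hAc : ∀ j, (A j)ᴴ * N - N * (A j)ᴴ = (a j : ℂ) • (A j)ᴴ := fun j ↦ by
    simpa [conjTranspose_sub, conjTranspose_mul, hN.eq] using congrArg conjTranspose (hA j)
  have hAB : ∀ j, Commute N ((A j)ᴴ * B j) := fun j ↦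
    commute_mul_of_opposite_weights (hB j) (hAc j)
  have hNH' : Commute N H' := by
    rw [hH']
    exact Commute.add_right hNH (Commute.sum_right _ _ _ fun j _ ↦ (hAB j).smul_right _)
  have hterm : ∀ j, γ j • (B j * (N * X - X * N) * (A j)ᴴ -
        (1 / 2 : ℂ) • ((A j)ᴴ * B j * (N * X - X * N) + (N * X - X * N) * ((A j)ᴴ * B j))) =
      N * (γ j • (B j * X * (A j)ᴴ -
        (1 / 2 : ℂ) • ((A j)ᴴ * B j * X + X * ((A j)ᴴ * B j)))) -
      (γ j • (B j * X * (A j)ᴴ -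
        (1 / 2 : ℂ) • ((A j)ᴴ * B j * X + X * ((A j)ᴴ * B j)))) * N := fun j ↦ by
    rw [sandwich_commutator (hB j) (hAc j), (hAB j).mul_commutator, (hAB j).commutator_mul]
    simp only [mul_smul_comm, smul_mul_assoc, mul_sub, sub_mul, mul_add, add_mul]
    module
  rw [hL, hL, Finset.sum_congr rfl fun j _ ↦ hterm j, Finset.sum_sub_distrib, ← Finset.mul_sum,
    ← Finset.sum_mul, hNH'.mul_commutator, hNH'.commutator_mul]
  simp only [mul_smul_comm, smul_mul_assoc, mul_sub, sub_mul, mul_add, add_mul]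
  module
end

section
/- Albert–Jiang implication (i) ⇒ (iii): let H be a Hermitian n×n complex matrix, (F_l)_{l∈Λ} a finite family of n×n complex matrices, and J a Hermitian n×n complex matrix such that JH = HJ and JF_l = F_l J for all l. Let L be the GKLS generator L(ρ) = −i(Hρ − ρH) + Σ_l (F_l ρ F_lᴴ − (1/2)(F_lᴴ F_l ρ + ρ F_lᴴ F_l)). Then J generates a continuous symmetry on the superoperator level: for every n×n complex matrix X, L(JX − XJ) = J·L(X) − L(X)·J. -/
open Matrix Finset

/-- **Albert–Jiang implication (i) ⇒ (iii).**
If a Hermitian observable `J` commutes with the Hamiltonian and with every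
Lindblad operator, then `J` generates a continuous symmetry on the
superoperator level: the GKLS generator `L` commutes with `𝒥 : X ↦ JX − XJ`. -/
theorem commuting_observable_generates_symmetry
    {n : ℕ} (H J : Matrix (Fin n) (Fin n) ℂ)
    (hH : H.IsHermitian) (hJ : J.IsHermitian)
    {Λ : Type*} [Fintype Λ] (F : Λ → Matrix (Fin n) (Fin n) ℂ)
    (hJH : J * H = H * J) (hJF : ∀ l, J * F l = F l * J)
    (L : Matrix (Fin n) (Fin n) ℂ →ₗ[ℂ] Matrix (Fin n) (Fin n) ℂ)
    (hL : ∀ ρ, L ρ = -Complex.I • (H * ρ - ρ * H) +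
      ∑ l, (F l * ρ * (F l)ᴴ -
        (1 / 2 : ℂ) • ((F l)ᴴ * F l * ρ + ρ * ((F l)ᴴ * F l)))) :
    ∀ X : Matrix (Fin n) (Fin n) ℂ,
      L (J * X - X * J) = J * L X - L X * J := by
  have hJFH : ∀ l, J * (F l)ᴴ = (F l)ᴴ * J := fun l => by
    have h := congrArg conjTranspose (hJF l)
    rw [conjTranspose_mul, conjTranspose_mul, hJ.eq] at h
    exact h.symm
  have hH' : ∀ A, H * (J * A) = J * (H * A) := fun A => by
    rw [← mul_assoc, ← hJH, mul_assoc]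
  have hF' : ∀ l A, F l * (J * A) = J * (F l * A) := fun l A => by
    rw [← mul_assoc, ← hJF, mul_assoc]
  have hFH' : ∀ l A, (F l)ᴴ * (J * A) = J * ((F l)ᴴ * A) := fun l A => by
    rw [← mul_assoc, ← hJFH, mul_assoc]
  have left_mul : ∀ X, L (J * X) = J * L X := fun X => by
    simp only [hL, mul_add, mul_sub, mul_smul_comm, mul_sum, mul_assoc, hH', hF', hFH']
  have mul_right : ∀ X, L (X * J) = L X * J := fun X => by
    simp only [hL, add_mul, sub_mul, smul_mul_assoc, sum_mul, mul_assoc, ← hJH, ← hJF, ← hJFH,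
      hFH']
  intro X
  rw [map_sub, left_mul, mul_right]
end
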